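/- For every λ ∈ ℂ with |λ| < a/3 the following identities hold: m₁(λ) + m₁*(λ) = q̃₁(λ)·q̃₁*(λ); m₂(λ) + m₃*(λ) = q̃₂(λ)·q̃₃*(λ); and m₃(λ) + m₂*(λ) = q̃₃(λ)·q̃₂*(λ). -/

import Mathlib

open Complex

noncomputable def ζ₁ : ℂ := 1
noncomputable def ζ₂ : ℂ := (-1 + Real.sqrt 3 * Complex.I) / 2
noncomputable def ζ₃ : ℂ := (-1 - Real.sqrt 3 * Complex.I) / 2

/-- `sfun p z = (1/3)·(ζ₁^(−p)·e^{zζ₁} + ζ₂^(−p)·e^{zζ₂} + ζ₃^(−p)·e^{zζ₃})`. -/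
noncomputable def sfun (p : ℕ) (z : ℂ) : ℂ :=
  ((ζ₁ ^ p)⁻¹ * Complex.exp (z * ζ₁) + (ζ₂ ^ p)⁻¹ * Complex.exp (z * ζ₂) +
    (ζ₃ ^ p)⁻¹ * Complex.exp (z * ζ₃)) / 3

open MeasureTheory Set

/-- q̃ for direction ζ: `∫₀^∞ e^{−iλζx} q(x) dx`. -/
noncomputable def qt (q : ℝ → ℂ) (ζ lam : ℂ) : ℂ :=
  ∫ x in Ioi (0:ℝ), Complex.exp (-Complex.I * lam * ζ * x) * q x

/-- Autocorrelation `g_q(s) = ∫₀^∞ q(x+s) conj(q(x)) dx`. -/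
noncomputable def gq (q : ℝ → ℂ) (s : ℝ) : ℂ :=
  ∫ x in Ioi (0:ℝ), q (x + s) * (starRingEnd ℂ) (q x)

/-- `m_k(λ) = ∫₀^∞ e^{−iλζ_k s} g_q(s) ds`. -/
noncomputable def mker (q : ℝ → ℂ) (ζ lam : ℂ) : ℂ :=
  ∫ s in Ioi (0:ℝ), Complex.exp (-Complex.I * lam * ζ * s) * gq q s

/-- `f*(λ) = conj (f (conj λ))`. -/
noncomputable def starF (f : ℂ → ℂ) (lam : ℂ) : ℂ :=
  (starRingEnd ℂ) (f ((starRingEnd ℂ) lam))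

/-- `m_{s₀}(λ) = (m₁(λ)+m₂(λ)+m₃(λ))/3`. -/
noncomputable def ms0 (q : ℝ → ℂ) (lam : ℂ) : ℂ :=
  (mker q ζ₁ lam + mker q ζ₂ lam + mker q ζ₃ lam) / 3

/-- `m_{s₂}(λ) = (ζ₁m₁(λ)+ζ₂m₂(λ)+ζ₃m₃(λ))/(3(iλ)²)`. -/
noncomputable def ms2 (q : ℝ → ℂ) (lam : ℂ) : ℂ :=
  (ζ₁ * mker q ζ₁ lam + ζ₂ * mker q ζ₂ lam + ζ₃ * mker q ζ₃ lam) /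
    (3 * (Complex.I * lam) ^ 2)

/-- `b(λ) = 1 + iα m_{s₂}(λ)`. -/
noncomputable def bcoef (α : ℝ) (q : ℝ → ℂ) (lam : ℂ) : ℂ :=
  1 + Complex.I * α * ms2 q lam

/-- Generic Jost solution with oscillation direction `ζk` and coefficient direction `ζc`. -/
noncomputable def jost (α : ℝ) (q : ℝ → ℂ) (ζk ζc : ℂ) (lam : ℂ) (x : ℝ) : ℂ :=
  bcoef α q lam * Complex.exp (Complex.I * lam * ζk * x) -
    Complex.I * α * starF (qt q ζc) lam *
      ∫ t in Ioi x, sfun 2 (Complex.I * lam * ((x : ℂ) - (t : ℂ))) / (Complex.I * lam) ^ 2 * q t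

/-- `ψ₁(λ,x)`. -/
noncomputable def psi1 (α : ℝ) (q : ℝ → ℂ) (lam : ℂ) (x : ℝ) : ℂ := jost α q ζ₁ ζ₁ lam x

/-- `ψ₂(λ,x)`. -/
noncomputable def psi2 (α : ℝ) (q : ℝ → ℂ) (lam : ℂ) (x : ℝ) : ℂ := jost α q ζ₂ ζ₃ lam x

/-- `ψ₃(λ,x)`. -/
noncomputable def psi3 (α : ℝ) (q : ℝ → ℂ) (lam : ℂ) (x : ℝ) : ℂ := jost α q ζ₃ ζ₂ lam x

/-- Square integrability with weight `e^{2ax}` gives integrability with weight `e^{wx}` when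
`‖w‖ < a`. -/
theorem integrableOn_exp_mul_of_sq_weight {a : ℝ} {q : ℝ → ℂ} (hq : Measurable q)
    (hint : IntegrableOn (fun x => Real.exp (2 * a * x) * ‖q x‖ ^ 2) (Ioi 0))
    {w : ℂ} (hw : ‖w‖ < a) :
    IntegrableOn (fun x : ℝ => Complex.exp (w * x) * q x) (Ioi 0) := by
  have hexp : IntegrableOn (fun x : ℝ => Real.exp (-(2 * (a - ‖w‖)) * x)) (Ioi 0) :=
    exp_neg_integrableOn_Ioi 0 (by linarith)
  refine Integrable.mono' (hexp.add hint) (by fun_prop) ?_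
  filter_upwards [ae_restrict_mem measurableSet_Ioi] with x (hx : 0 < x)
  have hre : (w * x).re ≤ ‖w‖ * x := by
    rw [Complex.re_mul_ofReal]
    exact mul_le_mul_of_nonneg_right (Complex.re_le_norm w) hx.le
  have h1 : ‖Complex.exp (w * x) * q x‖ ≤
      Real.exp (-(a - ‖w‖) * x) * (Real.exp (a * x) * ‖q x‖) := by
    rw [norm_mul, Complex.norm_exp, ← mul_assoc, ← Real.exp_add]
    gcongr
    linarith
  have h2 : Real.exp (-(2 * (a - ‖w‖)) * x) = Real.exp (-(a - ‖w‖) * x) ^ 2 := by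
    rw [← Real.exp_nat_mul]; congr 1; push_cast; ring
  have h3 : Real.exp (2 * a * x) * ‖q x‖ ^ 2 = (Real.exp (a * x) * ‖q x‖) ^ 2 := by
    rw [mul_pow, ← Real.exp_nat_mul]; congr 2; push_cast; ring
  simp only [Pi.add_apply, h2, h3]
  nlinarith [sq_nonneg (Real.exp (-(a - ‖w‖) * x) - Real.exp (a * x) * ‖q x‖),
    sq_nonneg (Real.exp (-(a - ‖w‖) * x)), sq_nonneg (Real.exp (a * x) * ‖q x‖)]

/-- Product of two half-line integrals, split along the diagonal. -/
theorem integral_Ioi_mul_integral_Ioi {u v : ℝ → ℂ} (hu : IntegrableOn u (Ioi 0))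
    (hv : IntegrableOn v (Ioi 0)) :
    (∫ x in Ioi (0:ℝ), u x) * (∫ y in Ioi (0:ℝ), v y) =
      (∫ s in Ioi (0:ℝ), ∫ x in Ioi (0:ℝ), u (x + s) * v x) +
        ∫ s in Ioi (0:ℝ), ∫ x in Ioi (0:ℝ), u x * v (x + s) := by
  set U := (Ioi (0:ℝ)).indicator u with hU
  set V := (Ioi (0:ℝ)).indicator v with hV
  have hUi : Integrable U := hu.integrable_indicator measurableSet_Ioi
  have hVi : Integrable V := hv.integrable_indicator measurableSet_Ioi
  have hc (s : ℝ) : MeasureTheory.convolution (fun t => V (-t)) U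
      (ContinuousLinearMap.mul ℝ ℂ) volume s = ∫ x, U (x + s) * V x := by
    rw [convolution_def, ← integral_neg_eq_self]
    refine integral_congr_ae (.of_forall fun x => ?_)
    simp only [neg_neg, sub_neg_eq_add, ContinuousLinearMap.mul_apply']
    rw [mul_comm, add_comm]
  have hI : Integrable fun s => ∫ x, U (x + s) * V x := by
    simpa only [funext hc] using
      hVi.comp_neg.integrable_convolution (ContinuousLinearMap.mul ℝ ℂ) hUi
  have hprod : ∫ s, ∫ x, U (x + s) * V x = (∫ x, U x) * ∫ y, V y := by
    have := integral_convolution (ContinuousLinearMap.mul ℝ ℂ) hVi.comp_neg hUi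
    simp only [hc, ContinuousLinearMap.mul_apply'] at this
    rw [this, integral_neg_eq_self, mul_comm]
  have hpos : ∫ s in Ioi (0:ℝ), ∫ x, U (x + s) * V x =
      ∫ s in Ioi (0:ℝ), ∫ x in Ioi (0:ℝ), u (x + s) * v x := by
    refine setIntegral_congr_fun measurableSet_Ioi fun s (hs : 0 < s) => ?_
    rw [← integral_indicator measurableSet_Ioi]
    refine integral_congr_ae (.of_forall fun x => ?_)
    by_cases hx : 0 < x
    · simp [hU, hV, hx, add_pos hx hs]
    · simp [hV, hx]
  have hneg : ∫ s in Iic (0:ℝ), ∫ x, U (x + s) * V x =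
      ∫ s in Ioi (0:ℝ), ∫ x in Ioi (0:ℝ), u x * v (x + s) := by
    have hflip := integral_comp_neg_Ioi 0 (fun s => ∫ x, U (x + s) * V x)
    rw [neg_zero] at hflip
    rw [← hflip]
    refine setIntegral_congr_fun measurableSet_Ioi fun s (hs : 0 < s) => ?_
    rw [← integral_indicator measurableSet_Ioi,
      ← integral_add_right_eq_self _ s]
    refine integral_congr_ae (.of_forall fun x => ?_)
    by_cases hx : 0 < x
    · simp [hU, hV, hx, add_pos hx hs]
    · simp [hU, hx]
  rw [← integral_indicator measurableSet_Ioi, ← integral_indicator measurableSet_Ioi, ← hprod,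
    ← hpos, ← hneg, add_comm, ← integral_add_compl measurableSet_Iic hI, compl_Iic]

theorem starF_qt (q : ℝ → ℂ) (ζ lam : ℂ) :
    starF (qt q ζ) lam = ∫ x in Ioi (0:ℝ),
      Complex.exp (-(-Complex.I * lam * (starRingEnd ℂ) ζ) * x) * (starRingEnd ℂ) (q x) := by
  simp [starF, qt, ← integral_conj, ← Complex.exp_conj]

theorem starF_mker (q : ℝ → ℂ) (ζ lam : ℂ) :
    starF (mker q ζ) lam = ∫ s in Ioi (0:ℝ),
      Complex.exp (-(-Complex.I * lam * (starRingEnd ℂ) ζ) * s) *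
        (starRingEnd ℂ) (gq q s) := by
  simp [starF, mker, ← integral_conj, ← Complex.exp_conj]

theorem mker_add_starF_mker {a : ℝ} {q : ℝ → ℂ} (hq : Measurable q)
    (hint : IntegrableOn (fun x => Real.exp (2 * a * x) * ‖q x‖ ^ 2) (Ioi 0))
    {ζ ζ' lam : ℂ} (hζ : (starRingEnd ℂ) ζ' = ζ) (hlam : ‖lam * ζ‖ < a) :
    mker q ζ lam + starF (mker q ζ') lam = qt q ζ lam * starF (qt q ζ') lam := by
  rw [starF_mker, starF_qt, hζ]
  unfold mker qt
  set w := -Complex.I * lam * ζ with hw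
  have hwa : ‖w‖ < a := by simpa [hw, norm_mul] using hlam
  have hv : IntegrableOn (fun x : ℝ => Complex.exp (-w * x) * (starRingEnd ℂ) (q x)) (Ioi 0) :=
    integrableOn_exp_mul_of_sq_weight (a := a) (Complex.continuous_conj.measurable.comp hq)
      (by simpa using hint) (by simpa using hwa)
  rw [integral_Ioi_mul_integral_Ioi (integrableOn_exp_mul_of_sq_weight hq hint hwa) hv]
  congr 1
  · refine integral_congr_ae (.of_forall fun s => ?_)
    simp only [gq]
    rw [← integral_const_mul]
    refine integral_congr_ae (.of_forall fun x => ?_)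
    have : Complex.exp (w * s) = Complex.exp (w * (x + s : ℝ)) * Complex.exp (-w * x) := by
      rw [← Complex.exp_add]; congr 1; push_cast; ring
    simp only [this]
    ring
  · refine integral_congr_ae (.of_forall fun s => ?_)
    simp only [gq]
    rw [← integral_conj, ← integral_const_mul]
    refine integral_congr_ae (.of_forall fun x => ?_)
    have : Complex.exp (-w * s) = Complex.exp (w * x) * Complex.exp (-w * (x + s : ℝ)) := by
      rw [← Complex.exp_add]; congr 1; push_cast; ring
    simp only [this, map_mul, Complex.conj_conj]
    ring

theorem conj_ζ₁ : (starRingEnd ℂ) ζ₁ = ζ₁ := by simp [ζ₁]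

theorem conj_ζ₂ : (starRingEnd ℂ) ζ₂ = ζ₃ := by
  simp [ζ₂, ζ₃, sub_eq_add_neg, Complex.conj_ofNat]

theorem conj_ζ₃ : (starRingEnd ℂ) ζ₃ = ζ₂ := by
  rw [← conj_ζ₂, Complex.conj_conj]

theorem norm_ζ₂ : ‖ζ₂‖ = 1 := by
  have h : ζ₂ = ⟨-1 / 2, Real.sqrt 3 / 2⟩ := by
    apply Complex.ext <;> simp [ζ₂]
  rw [h, Complex.norm_def, Complex.normSq_mk, Real.sqrt_eq_one]
  nlinarith [Real.sq_sqrt (show (0:ℝ) ≤ 3 by norm_num)]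

theorem norm_ζ₃ : ‖ζ₃‖ = 1 := by
  rw [← conj_ζ₂, Complex.norm_conj, norm_ζ₂]

theorem stmt12 (a : ℝ) (ha : 0 < a) (q : ℝ → ℂ) (hq : Measurable q)
    (hint : IntegrableOn (fun x => Real.exp (2 * a * x) * ‖q x‖ ^ 2) (Ioi 0))
    (lam : ℂ) (hlam : ‖lam‖ < a / 3) :
    mker q ζ₁ lam + starF (mker q ζ₁) lam = qt q ζ₁ lam * starF (qt q ζ₁) lam ∧
    mker q ζ₂ lam + starF (mker q ζ₃) lam = qt q ζ₂ lam * starF (qt q ζ₃) lam ∧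
    mker q ζ₃ lam + starF (mker q ζ₂) lam = qt q ζ₃ lam * starF (qt q ζ₂) lam := by
  have hlt : ‖lam‖ < a := by linarith
  refine ⟨mker_add_starF_mker hq hint conj_ζ₁ ?_, mker_add_starF_mker hq hint conj_ζ₃ ?_,
    mker_add_starF_mker hq hint conj_ζ₂ ?_⟩
  · simpa [ζ₁] using hlt
  · simpa [norm_ζ₂] using hlt
  · simpa [norm_ζ₃] using hlt
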